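/- For given N and s, consider the frame potential FP as a function on the s-fold product of the unit sphere of ℂ^N, FP(φ_1, …, φ_s) = Σ_{j,k} |⟨φ_j, φ_k⟩|². Every local minimizer of FP on this product of spheres is a global minimizer. -/

import Mathlib

open scoped InnerProductSpace

section FPHelpers

open Topology Filter ComplexConjugate

variable {E : Type*} [NormedAddCommGroup E] [InnerProductSpace ℂ E]

lemma fp_norm_expand (A B C : ℂ) (t : ℝ) :
    ‖A + t * B + (t:ℂ)^2 * C‖ ^ 2 = ‖A‖^2 + 2 * t * (conj A * B).re
      + t^2 * (‖B‖^2 + 2 * (conj A * C).re) + 2 * t^3 * (conj B * C).re + t^4 * ‖C‖^2 := by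
  simp only [← Complex.normSq_eq_norm_sq, Complex.normSq_apply]
  simp [pow_two]
  ring

/-- second order condition -/
lemma fp_second_order {s : ℕ} (φ : Fin s → E) (e : E) (he : ‖e‖ = 1)
    (μ : ℝ) (hμ : ∀ x, ∑ j, ⟪x, φ j⟫_ℂ * ⟪φ j, e⟫_ℂ = μ * ⟪x, e⟫_ℂ)
    (w : Fin s → ℂ) (hw : ∀ j, w j * ⟪φ j, e⟫_ℂ = 0) (hker : ∑ j, conj (w j) • φ j = 0)
    (hloc : ∀ᶠ t : ℝ in 𝓝 0, ∑ j, ∑ k, ‖⟪φ j, φ k⟫_ℂ‖^2 ≤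
      ∑ j, ∑ k, (1 + t^2 * ‖w j‖^2)⁻¹ * (1 + t^2 * ‖w k‖^2)⁻¹ *
        ‖⟪φ j + ((t:ℂ) * w j) • e, φ k + ((t:ℂ) * w k) • e⟫_ℂ‖^2) :
    0 ≤ ∑ k, ‖w k‖^2 * (μ - ∑ j, ‖⟪φ j, φ k⟫_ℂ‖^2) := by
  have hee : ⟪e, e⟫_ℂ = 1 := by rw [inner_self_eq_norm_sq_to_K, he]; simp
  set h : Fin s → Fin s → ℂ := fun j k => conj (w j) * ⟪e, φ k⟫_ℂ + w k * ⟪φ j, e⟫_ℂ with hh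
  have hw' : ∀ j, conj (w j) * ⟪e, φ j⟫_ℂ = 0 := by
    intro j
    have := congrArg conj (hw j)
    simpa using this
  have hin : ∀ (t : ℝ) j k, ⟪φ j + ((t:ℂ) * w j) • e, φ k + ((t:ℂ) * w k) • e⟫_ℂ
      = ⟪φ j, φ k⟫_ℂ + t * h j k + (t:ℂ)^2 * (conj (w j) * w k) := by
    intro t j k
    simp only [inner_add_left, inner_add_right, inner_smul_left, inner_smul_right, hee, hh,
      map_mul, Complex.conj_ofReal]
    ring
  have hcub : ∀ j k, conj (h j k) * (conj (w j) * w k) = 0 := by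
    intro j k
    simp only [hh, map_add, map_mul, Complex.conj_conj, inner_conj_symm]
    linear_combination (w j * conj (w j)) * hw k + (w k * conj (w k)) * hw' j
  have hlin1 : ∀ (t : ℝ), ∑ j, ∑ k, (((1 + t^2 * ‖w j‖^2)⁻¹ * (1 + t^2 * ‖w k‖^2)⁻¹ : ℝ) : ℂ) *
      (conj ⟪φ j, φ k⟫_ℂ * (w k * ⟪φ j, e⟫_ℂ)) = 0 := by
    intro t
    rw [Finset.sum_comm]
    apply Finset.sum_eq_zero
    intro k _
    have h1 : ∀ j, (((1 + t^2 * ‖w j‖^2)⁻¹ * (1 + t^2 * ‖w k‖^2)⁻¹ : ℝ) : ℂ) *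
      (conj ⟪φ j, φ k⟫_ℂ * (w k * ⟪φ j, e⟫_ℂ)) =
       (((1 + t^2 * ‖w k‖^2)⁻¹ : ℝ) : ℂ) * w k * (⟪φ k, φ j⟫_ℂ * ⟪φ j, e⟫_ℂ) := by
      intro j
      rw [inner_conj_symm]
      rcases mul_eq_zero.1 (hw j) with h0 | h0
      · simp [h0]; ring
      · simp [h0]
    rw [Finset.sum_congr rfl (fun j _ => h1 j), ← Finset.mul_sum, hμ]
    linear_combination (((1 + t^2 * ‖w k‖^2)⁻¹ : ℝ) : ℂ) * μ * hw k
  have hlin2 : ∀ (t : ℝ), ∑ j, ∑ k, (((1 + t^2 * ‖w j‖^2)⁻¹ * (1 + t^2 * ‖w k‖^2)⁻¹ : ℝ) : ℂ) *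
      (conj ⟪φ j, φ k⟫_ℂ * (conj (w j) * ⟪e, φ k⟫_ℂ)) = 0 := by
    intro t
    have := congrArg conj (hlin1 t)
    rw [map_zero, map_sum, Finset.sum_congr rfl (fun _ _ => map_sum _ _ _), Finset.sum_comm] at this
    rw [← this]
    refine Finset.sum_congr rfl fun j _ => Finset.sum_congr rfl fun k _ => ?_
    simp only [map_mul, Complex.conj_ofReal, inner_conj_symm]
    push_cast
    ring
  have hlin : ∀ (t : ℝ), ∑ j, ∑ k, ((1 + t^2 * ‖w j‖^2)⁻¹ * (1 + t^2 * ‖w k‖^2)⁻¹) *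
      (conj ⟪φ j, φ k⟫_ℂ * h j k).re = 0 := by
    intro t
    have := congrArg Complex.re (congrArg₂ (· + ·) (hlin1 t) (hlin2 t))
    simp only [← Finset.sum_add_distrib, Complex.re_sum, ← mul_add, Complex.re_ofReal_mul,
      add_zero, Complex.zero_re] at this
    rw [← this]
    refine Finset.sum_congr rfl fun j _ => Finset.sum_congr rfl fun k _ => ?_
    rw [hh]; simp only [add_comm]
  set H : ℝ → ℝ := fun t => ∑ j, ∑ k, (1 + t^2 * ‖w j‖^2)⁻¹ * (1 + t^2 * ‖w k‖^2)⁻¹ *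
    (-(‖w j‖^2 + ‖w k‖^2 + t^2 * ‖w j‖^2 * ‖w k‖^2) * ‖⟪φ j, φ k⟫_ℂ‖^2
      + ‖h j k‖^2 + 2 * (conj ⟪φ j, φ k⟫_ℂ * (conj (w j) * w k)).re
      + t^2 * ‖conj (w j) * w k‖^2) with hH
  have hpos : ∀ (t : ℝ) j, (1 + t^2 * ‖w j‖^2) ≠ 0 := fun t j => by positivity
  have hexp : ∀ t : ℝ, ∑ j, ∑ k, (1 + t^2 * ‖w j‖^2)⁻¹ * (1 + t^2 * ‖w k‖^2)⁻¹ *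
        ‖⟪φ j + ((t:ℂ) * w j) • e, φ k + ((t:ℂ) * w k) • e⟫_ℂ‖^2
      = ∑ j, ∑ k, ‖⟪φ j, φ k⟫_ℂ‖^2 + t^2 * H t := by
    intro t
    have h2 : ∑ j, ∑ k, (1 + t^2 * ‖w j‖^2)⁻¹ * (1 + t^2 * ‖w k‖^2)⁻¹ *
        ‖⟪φ j + ((t:ℂ) * w j) • e, φ k + ((t:ℂ) * w k) • e⟫_ℂ‖^2
      = ∑ j, ∑ k, ‖⟪φ j, φ k⟫_ℂ‖^2 + t^2 * H t + 2 * t * (∑ j, ∑ k, ((1 + t^2 * ‖w j‖^2)⁻¹ * (1 + t^2 * ‖w k‖^2)⁻¹) *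
      (conj ⟪φ j, φ k⟫_ℂ * h j k).re) := by
      simp only [hH, Finset.mul_sum, ← Finset.sum_add_distrib]
      refine Finset.sum_congr rfl fun j _ => Finset.sum_congr rfl fun k _ => ?_
      rw [hin, fp_norm_expand, hcub]
      have := hpos t j
      have := hpos t k
      simp only [Complex.zero_re]
      generalize (conj ⟪φ j, φ k⟫_ℂ * h j k).re = X1
      generalize (conj ⟪φ j, φ k⟫_ℂ * (conj (w j) * w k)).re = X2
      generalize ‖conj (w j) * w k‖ = X3
      field_simp
      ring
    rw [h2, hlin]; ring
  have hcont : Continuous H := by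
    rw [hH]
    refine continuous_finsetSum _ fun j _ => continuous_finsetSum _ fun k _ => ?_
    have h1 : Continuous fun t : ℝ => (1 + t^2 * ‖w j‖^2)⁻¹ :=
      Continuous.inv₀ (by fun_prop) (fun t => hpos t j)
    have h2 : Continuous fun t : ℝ => (1 + t^2 * ‖w k‖^2)⁻¹ :=
      Continuous.inv₀ (by fun_prop) (fun t => hpos t k)
    fun_prop
  have hH0 : 0 ≤ H 0 := by
    have ht : Tendsto H (𝓝[≠] 0) (𝓝 (H 0)) := hcont.continuousAt.tendsto.mono_left nhdsWithin_le_nhds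
    refine ge_of_tendsto ht ?_
    filter_upwards [hloc.filter_mono nhdsWithin_le_nhds, self_mem_nhdsWithin] with t ht ht0
    rw [hexp] at ht
    have : 0 < t^2 := by have : t ≠ 0 := ht0; positivity
    by_contra hc
    push Not at hc
    nlinarith
  have hμ' : ∑ j, ‖⟪φ j, e⟫_ℂ‖^2 = μ := by
    have := hμ e
    rw [hee] at this
    have h3 : ((∑ j, ‖⟪φ j, e⟫_ℂ‖^2 : ℝ) : ℂ) = (μ : ℂ) := by
      rw [← mul_one (μ : ℂ), ← this]
      push_cast
      refine Finset.sum_congr rfl fun j _ => ?_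
      rw [← inner_conj_symm e (φ j), Complex.conj_mul']
    exact_mod_cast h3
  have hk0 : ∑ j, ∑ k, (conj ⟪φ j, φ k⟫_ℂ * (conj (w j) * w k)).re = 0 := by
    have h4 : ⟪∑ j, conj (w j) • φ j, ∑ j, conj (w j) • φ j⟫_ℂ = 0 := by rw [hker]; simp
    rw [sum_inner] at h4
    simp only [inner_sum, inner_smul_left, inner_smul_right, Complex.conj_conj] at h4
    rw [Finset.sum_comm] at h4
    have h5 := congrArg Complex.re h4
    simp only [Complex.re_sum, Complex.zero_re] at h5
    rw [← h5]
    refine Finset.sum_congr rfl fun j _ => Finset.sum_congr rfl fun k _ => ?_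
    rw [inner_conj_symm]
    congr 1
    ring
  have hhn : ∀ j k, ‖h j k‖^2 = ‖w j‖^2 * ‖⟪φ k, e⟫_ℂ‖^2 + ‖w k‖^2 * ‖⟪φ j, e⟫_ℂ‖^2 := by
    intro j k
    have h6 : ((‖h j k‖^2 : ℝ) : ℂ) =
        ((‖w j‖^2 * ‖⟪φ k, e⟫_ℂ‖^2 + ‖w k‖^2 * ‖⟪φ j, e⟫_ℂ‖^2 : ℝ) : ℂ) := by
      push_cast
      simp only [← Complex.conj_mul']
      simp only [hh, map_add, map_mul, Complex.conj_conj, inner_conj_symm]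
      linear_combination (conj (w k) * ⟪e, φ k⟫_ℂ) * hw' j + (w k * ⟪φ k, e⟫_ℂ) * hw j
    exact_mod_cast h6
  have hval : H 0 = 2 * ∑ k, ‖w k‖^2 * (μ - ∑ j, ‖⟪φ j, φ k⟫_ℂ‖^2) := by
    have h7 : H 0 = ∑ j, ∑ k, (-(‖w j‖^2 * ‖⟪φ k, φ j⟫_ℂ‖^2)) + ∑ j, ∑ k, (-(‖w k‖^2 * ‖⟪φ j, φ k⟫_ℂ‖^2))
       + ∑ j, ∑ k, ‖w j‖^2 * ‖⟪φ k, e⟫_ℂ‖^2 + ∑ j, ∑ k, ‖w k‖^2 * ‖⟪φ j, e⟫_ℂ‖^2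
       + 2 * ∑ j, ∑ k, (conj ⟪φ j, φ k⟫_ℂ * (conj (w j) * w k)).re := by
      simp only [hH, Finset.mul_sum, ← Finset.sum_add_distrib]
      refine Finset.sum_congr rfl fun j _ => Finset.sum_congr rfl fun k _ => ?_
      rw [hhn, norm_inner_symm (φ k) (φ j)]
      simp
      ring
    rw [h7, hk0, Finset.sum_comm (f := fun j k => (-(‖w k‖^2 * ‖⟪φ j, φ k⟫_ℂ‖^2))),
      Finset.sum_comm (f := fun j k => ‖w k‖^2 * ‖⟪φ j, e⟫_ℂ‖^2)]
    simp only [← Finset.mul_sum, hμ', Finset.sum_neg_distrib, mul_sub, Finset.sum_sub_distrib]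
    ring
  linarith

/-- partial frame operator -/
noncomputable def fpS {s : ℕ} (J : Finset (Fin s)) (φ : Fin s → E) : E →L[ℂ] E :=
  ∑ j ∈ J, (innerSL ℂ (φ j)).smulRight (φ j)

lemma fpS_apply {s : ℕ} (J : Finset (Fin s)) (φ : Fin s → E) (x : E) :
    fpS J φ x = ∑ j ∈ J, ⟪φ j, x⟫_ℂ • φ j := by
  simp [fpS]

lemma fpS_inner {s : ℕ} (J : Finset (Fin s)) (φ : Fin s → E) (x y : E) :
    ⟪x, fpS J φ y⟫_ℂ = ∑ j ∈ J, ⟪x, φ j⟫_ℂ * ⟪φ j, y⟫_ℂ := by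
  rw [fpS_apply, inner_sum]
  refine Finset.sum_congr rfl fun j _ => ?_
  rw [inner_smul_right]; ring

lemma fpS_self {s : ℕ} (J : Finset (Fin s)) (φ : Fin s → E) (x : E) :
    ⟪x, fpS J φ x⟫_ℂ = ((∑ j ∈ J, ‖⟪φ j, x⟫_ℂ‖^2 : ℝ) : ℂ) := by
  rw [fpS_inner]
  push_cast
  refine Finset.sum_congr rfl fun j _ => ?_
  rw [← inner_conj_symm x (φ j), Complex.conj_mul']

lemma fpS_symm {s : ℕ} (J : Finset (Fin s)) (φ : Fin s → E) (x y : E) :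
    ⟪fpS J φ x, y⟫_ℂ = ⟪x, fpS J φ y⟫_ℂ := by
  rw [← inner_conj_symm, fpS_inner, fpS_inner, map_sum]
  refine Finset.sum_congr rfl fun j _ => ?_
  rw [map_mul, inner_conj_symm, inner_conj_symm]; ring

lemma fpS_eig [FiniteDimensional ℂ E] {s : ℕ} (J : Finset (Fin s)) (φ : Fin s → E) (x : E) (hx : ‖x‖ = 1)
    (hext : IsLocalMinOn (fun y => ∑ j ∈ J, ‖⟪φ j, y⟫_ℂ‖^2) (Metric.sphere 0 1) x) :
    fpS J φ x = ((∑ j ∈ J, ‖⟪φ j, x⟫_ℂ‖^2 : ℝ) : ℂ) • x := by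
  haveI : CompleteSpace E := FiniteDimensional.complete ℂ E
  have hsa : IsSelfAdjoint (fpS J φ) := by
    rw [ContinuousLinearMap.isSelfAdjoint_iff_isSymmetric]
    intro a b
    exact fpS_symm J φ a b
  have hre : ∀ y, (fpS J φ).reApplyInnerSelf y = ∑ j ∈ J, ‖⟪φ j, y⟫_ℂ‖^2 := by
    intro y
    rw [ContinuousLinearMap.reApplyInnerSelf_apply, fpS_symm, fpS_self]
    exact Complex.ofReal_re _
  have h1 := hsa.eq_smul_self_of_isLocalExtrOn (x₀ := x) (by
    rw [hx, funext hre]; exact Or.inl hext)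
  rw [h1]
  simp [ContinuousLinearMap.rayleighQuotient, hre, hx]

lemma fp_trace {ι : Type*} [Fintype ι] {s : ℕ} (b : OrthonormalBasis ι ℂ E) (φ : Fin s → E)
    (hφ : ∀ j, ‖φ j‖ = 1) : ∑ i, ∑ j, ‖⟪φ j, b i⟫_ℂ‖^2 = s := by
  rw [Finset.sum_comm]
  simp [b.sum_sq_norm_inner_left, hφ]

lemma fp_lower {ι : Type*} [Fintype ι] {s : ℕ} (b : OrthonormalBasis ι ℂ E) (φ : Fin s → E)
    (hφ : ∀ j, ‖φ j‖ = 1) :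
    (s : ℝ)^2 ≤ Fintype.card ι * ∑ j, ∑ k, ‖⟪φ j, φ k⟫_ℂ‖^2 := by
  set q : ι → ℝ := fun i => ∑ j, ‖⟪φ j, b i⟫_ℂ‖^2 with hq
  have h1 : ∀ i, q i ^ 2 ≤ ‖fpS Finset.univ φ (b i)‖^2 := by
    intro i
    have h2 := norm_inner_le_norm (𝕜 := ℂ) (b i) (fpS Finset.univ φ (b i))
    rw [fpS_self, b.norm_eq_one, one_mul, Complex.norm_real] at h2
    have h3 : 0 ≤ q i := by positivity
    rw [Real.norm_of_nonneg h3] at h2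
    gcongr
  have h4 : ∑ i, ‖fpS Finset.univ φ (b i)‖^2 = ∑ j, ∑ k, ‖⟪φ j, φ k⟫_ℂ‖^2 := by
    have h5 : ((∑ i, ‖fpS Finset.univ φ (b i)‖^2 : ℝ) : ℂ) =
        ((∑ j, ∑ k, ‖⟪φ j, φ k⟫_ℂ‖^2 : ℝ) : ℂ) := by
      push_cast
      have h6 : ∀ i, ((‖fpS Finset.univ φ (b i)‖ : ℂ))^2 =
          ∑ j, ∑ k, ⟪φ k, φ j⟫_ℂ * (⟪φ j, b i⟫_ℂ * ⟪b i, φ k⟫_ℂ) := by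
        intro i
        have := inner_self_eq_norm_sq_to_K (𝕜 := ℂ) (fpS Finset.univ φ (b i))
        refine this.symm.trans ?_
        rw [fpS_inner]
        refine Finset.sum_congr rfl fun j _ => ?_
        rw [fpS_symm, fpS_inner, Finset.sum_mul]
        refine Finset.sum_congr rfl fun k _ => ?_
        ring
      rw [Finset.sum_congr rfl fun i _ => h6 i, Finset.sum_comm]
      refine Finset.sum_congr rfl fun j _ => ?_
      rw [Finset.sum_comm]
      refine Finset.sum_congr rfl fun k _ => ?_
      rw [← Finset.mul_sum, b.sum_inner_mul_inner, ← Complex.conj_mul', inner_conj_symm]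
    exact_mod_cast h5
  rw [← h4, ← fp_trace b φ hφ]
  calc (∑ i, q i)^2 ≤ Fintype.card ι * ∑ i, q i ^ 2 := by
        have := sq_sum_le_card_mul_sum_sq (s := Finset.univ) (f := q)
        simpa using this
    _ ≤ _ := mul_le_mul_of_nonneg_left (Finset.sum_le_sum fun i _ => h1 i) (by positivity)

lemma fp_lower_one {s : ℕ} (φ : Fin s → E) (hφ : ∀ j, ‖φ j‖ = 1) (k : Fin s) :
    1 ≤ ∑ j, ‖⟪φ j, φ k⟫_ℂ‖^2 := by
  have h1 : ‖⟪φ k, φ k⟫_ℂ‖^2 = 1 := by rw [inner_self_eq_norm_sq_to_K, hφ]; simp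
  rw [← h1]
  exact Finset.single_le_sum (f := fun j => ‖⟪φ j, φ k⟫_ℂ‖^2) (fun _ _ => by positivity)
    (Finset.mem_univ k)

end FPHelpers

open Topology Filter ComplexConjugate in
lemma fp_first_order
    (N s : ℕ)
    (FP : (Fin s → Metric.sphere (0 : EuclideanSpace ℂ (Fin N)) 1) → ℝ)
    (hFP : ∀ φ, FP φ = ∑ j, ∑ k, ‖⟪(φ j : EuclideanSpace ℂ (Fin N)), (φ k : EuclideanSpace ℂ (Fin N))⟫_ℂ‖ ^ 2)
    (φ₀ : Fin s → Metric.sphere (0 : EuclideanSpace ℂ (Fin N)) 1)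
    (hmin : IsLocalMin FP φ₀) (k : Fin s) :
    fpS Finset.univ (fun j => (φ₀ j : EuclideanSpace ℂ (Fin N))) (φ₀ k) =
      ((∑ j, ‖⟪(φ₀ j : EuclideanSpace ℂ (Fin N)), (φ₀ k : EuclideanSpace ℂ (Fin N))⟫_ℂ‖^2 : ℝ) : ℂ)
        • (φ₀ k : EuclideanSpace ℂ (Fin N)) := by
  classical
  set φ : Fin s → EuclideanSpace ℂ (Fin N) := fun j => (φ₀ j : EuclideanSpace ℂ (Fin N)) with hφd
  have hφ : ∀ j, ‖φ j‖ = 1 := fun j => mem_sphere_zero_iff_norm.1 (φ₀ j).2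
  have hself : ∀ x : Metric.sphere (0 : EuclideanSpace ℂ (Fin N)) 1, ‖⟪(x : EuclideanSpace ℂ (Fin N)), (x : EuclideanSpace ℂ (Fin N))⟫_ℂ‖^2 = 1 := by
    intro x
    have hx : ‖(x : EuclideanSpace ℂ (Fin N))‖ = 1 := by simpa using x.2
    rw [inner_self_eq_norm_sq_to_K, hx]; simp
  set J := Finset.univ.erase k with hJ
  have hupd : ∀ x, FP (Function.update φ₀ k x) = 1 + ∑ i ∈ J, ∑ j ∈ J, ‖⟪φ i, φ j⟫_ℂ‖^2
      + 2 * ∑ j ∈ J, ‖⟪φ j, (x : EuclideanSpace ℂ (Fin N))⟫_ℂ‖^2 := by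
    intro x
    rw [hFP, ← Finset.add_sum_erase _ _ (Finset.mem_univ k), ← Finset.add_sum_erase _ _ (Finset.mem_univ k)]
    have h1 : ∀ i ∈ J, ∑ j, ‖⟪(Function.update φ₀ k x i : EuclideanSpace ℂ (Fin N)), (Function.update φ₀ k x j : EuclideanSpace ℂ (Fin N))⟫_ℂ‖^2
       = ‖⟪φ i, (x : EuclideanSpace ℂ (Fin N))⟫_ℂ‖^2 + ∑ j ∈ J, ‖⟪φ i, φ j⟫_ℂ‖^2 := by
      intro i hi
      rw [← Finset.add_sum_erase _ _ (Finset.mem_univ k)]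
      rw [Function.update_of_ne (Finset.ne_of_mem_erase hi), Function.update_self]
      congr 1
      refine Finset.sum_congr rfl fun j hj => ?_
      rw [Function.update_of_ne (Finset.ne_of_mem_erase hj)]
    have h2 : ∀ j ∈ J, ‖⟪(Function.update φ₀ k x k : EuclideanSpace ℂ (Fin N)), (Function.update φ₀ k x j : EuclideanSpace ℂ (Fin N))⟫_ℂ‖^2
       = ‖⟪φ j, (x : EuclideanSpace ℂ (Fin N))⟫_ℂ‖^2 := by
      intro j hj
      rw [Function.update_of_ne (Finset.ne_of_mem_erase hj), Function.update_self, norm_inner_symm]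
    rw [Finset.sum_congr rfl h1, Finset.sum_congr rfl h2, Finset.sum_add_distrib,
      Function.update_self, hself]
    ring
  have hloc : IsLocalMinOn (fun y => ∑ j ∈ J, ‖⟪φ j, y⟫_ℂ‖^2) (Metric.sphere 0 1) (φ k) := by
    have hc : Continuous fun x => Function.update φ₀ k x := continuous_const.update k continuous_id
    have ht : Tendsto (fun x => Function.update φ₀ k x) (𝓝 (φ₀ k)) (𝓝 φ₀) := by
      have := hc.tendsto (φ₀ k)
      rwa [Function.update_eq_self] at this
    have h3 : ∀ᶠ x in 𝓝 (φ₀ k), FP φ₀ ≤ FP (Function.update φ₀ k x) := ht.eventually hmin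
    have h4 : FP φ₀ = FP (Function.update φ₀ k (φ₀ k)) := by rw [Function.update_eq_self]
    rw [h4] at h3
    unfold IsLocalMinOn IsMinFilter
    rw [← map_nhds_subtype_val (φ₀ k), eventually_map]
    filter_upwards [h3] with x hx
    rw [hupd, hupd] at hx
    linarith
  have h5 := fpS_eig J φ (φ k) (hφ k) hloc
  change fpS Finset.univ φ (φ k) = ((∑ j, ‖⟪φ j, φ k⟫_ℂ‖^2 : ℝ) : ℂ) • φ k
  rw [fpS_apply] at h5 ⊢
  rw [← Finset.add_sum_erase _ _ (Finset.mem_univ k), h5,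
    ← Finset.add_sum_erase _ (fun j => ‖⟪φ j, φ k⟫_ℂ‖^2) (Finset.mem_univ k)]
  have h6 : ‖⟪φ k, φ k⟫_ℂ‖^2 = 1 := hself (φ₀ k)
  have h7 : ⟪φ k, φ k⟫_ℂ = 1 := by rw [inner_self_eq_norm_sq_to_K, hφ]; simp
  rw [h6, h7, Complex.ofReal_add, add_smul, Complex.ofReal_one]

open Topology Filter ComplexConjugate in
/-- **Theorem 3 (part 1, Benedetto–Fickus).** Consider the frame potential
`FP(φ_1, …, φ_s) = Σ_{j,k} |⟨φ_j, φ_k⟩|²` as a function on the `s`-fold product of the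
unit sphere of `ℂ^N`.  Every local minimizer of `FP` is a global minimizer. -/
theorem frame_potential_local_min_global
    (N s : ℕ)
    (FP : (Fin s → Metric.sphere (0 : EuclideanSpace ℂ (Fin N)) 1) → ℝ)
    (hFP : ∀ φ, FP φ = ∑ j, ∑ k, ‖⟪(φ j : EuclideanSpace ℂ (Fin N)), (φ k : EuclideanSpace ℂ (Fin N))⟫_ℂ‖ ^ 2)
    (φ₀ : Fin s → Metric.sphere (0 : EuclideanSpace ℂ (Fin N)) 1)
    (hmin : IsLocalMin FP φ₀) :
    ∀ ψ : Fin s → Metric.sphere (0 : EuclideanSpace ℂ (Fin N)) 1, FP φ₀ ≤ FP ψ := by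
  classical
  intro ψ
  rcases Nat.eq_zero_or_pos s with hs | hs
  · subst hs; rw [Subsingleton.elim ψ φ₀]
  have hfirst := fp_first_order N s FP hFP φ₀ hmin
  have hFP0 := hFP φ₀
  set φ : Fin s → EuclideanSpace ℂ (Fin N) := fun j => (φ₀ j : EuclideanSpace ℂ (Fin N)) with hφd
  have hφ : ∀ j, ‖φ j‖ = 1 := fun j => mem_sphere_zero_iff_norm.1 (φ₀ j).2
  have hψ : ∀ j, ‖(ψ j : EuclideanSpace ℂ (Fin N))‖ = 1 := fun j => mem_sphere_zero_iff_norm.1 (ψ j).2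
  set lam : Fin s → ℝ := fun k => ∑ j, ‖⟪φ j, φ k⟫_ℂ‖^2 with hlam
  have hfirst' : ∀ k, fpS Finset.univ φ (φ k) = (lam k : ℂ) • φ k := hfirst
  obtain ⟨e, heS, hemin⟩ := (isCompact_sphere (0 : EuclideanSpace ℂ (Fin N)) 1).exists_isMinOn
    ⟨φ ⟨0, hs⟩, (φ₀ ⟨0, hs⟩).2⟩
    (f := fun y => ∑ j, ‖⟪φ j, y⟫_ℂ‖^2) (by fun_prop)
  have he : ‖e‖ = 1 := by simpa using heS
  have heig := fpS_eig Finset.univ φ e he (hemin.localize)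
  set μ : ℝ := ∑ j, ‖⟪φ j, e⟫_ℂ‖^2 with hμ
  have hμle : ∀ x : EuclideanSpace ℂ (Fin N), ‖x‖ = 1 → μ ≤ ∑ j, ‖⟪φ j, x⟫_ℂ‖^2 := by
    intro x hx
    exact hemin (by simpa using hx)
  have hlamμ : ∀ k, μ ≤ lam k := fun k => hμle _ (hφ k)
  have horth : ∀ k, ((lam k - μ : ℝ) : ℂ) * ⟪φ k, e⟫_ℂ = 0 := by
    intro k
    have h1 := fpS_symm Finset.univ φ (φ k) e
    rw [hfirst', heig, inner_smul_left, inner_smul_right, Complex.conj_ofReal] at h1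
    push_cast
    linear_combination h1
  have hkey : ∀ c : Fin s → ℂ, ∑ j, c j • φ j = 0 → ∀ k, c k * ((lam k - μ : ℝ) : ℂ) = 0 := by
    intro c hc
    set w : Fin s → ℂ := fun j => conj (c j) * ((lam j - μ : ℝ) : ℂ) with hwd
    have hker : ∑ j, conj (w j) • φ j = 0 := by
      have h2 := congrArg (fpS Finset.univ φ) hc
      rw [map_sum, map_zero] at h2
      have h3 : ∀ j, conj (w j) • φ j = fpS Finset.univ φ (c j • φ j) - (μ : ℂ) • (c j • φ j) := by
        intro j
        rw [map_smul, hfirst', smul_smul, smul_smul, ← sub_smul]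
        congr 1
        simp [hwd]
        ring
      rw [Finset.sum_congr rfl fun j _ => h3 j, Finset.sum_sub_distrib, h2, ← Finset.smul_sum, hc]
      simp
    have hw : ∀ j, w j * ⟪φ j, e⟫_ℂ = 0 := by
      intro j
      rw [hwd]
      linear_combination conj (c j) * horth j
    have hsec := fp_second_order φ e he μ (by
      intro x
      rw [← fpS_inner, heig, inner_smul_right]) w hw hker (by
      have hn : ∀ (t : ℝ) j, ‖φ j + ((t:ℂ) * w j) • e‖^2 = 1 + t^2 * ‖w j‖^2 := by
        intro t j
        rw [@norm_add_sq ℂ, inner_smul_right, mul_assoc, hw, norm_smul, he, hφ]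
        simp [mul_pow]
      have hpos : ∀ (t : ℝ) j, 0 < 1 + t^2 * ‖w j‖^2 := fun t j => by positivity
      have hn' : ∀ (t : ℝ) j, 0 < ‖φ j + ((t:ℂ) * w j) • e‖ := fun t j => by
        have h1 := hn t j
        have h2 := hpos t j
        by_contra hcon
        have h0 : ‖φ j + ((t:ℂ) * w j) • e‖ = 0 := le_antisymm (not_lt.1 hcon) (norm_nonneg _)
        rw [h0] at h1
        norm_num at h1
        linarith
      let γ : ℝ → Fin s → Metric.sphere (0 : EuclideanSpace ℂ (Fin N)) 1 := fun t j =>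
        ⟨((‖φ j + ((t:ℂ) * w j) • e‖⁻¹ : ℝ) : ℂ) • (φ j + ((t:ℂ) * w j) • e), by
          rw [mem_sphere_zero_iff_norm, norm_smul, Complex.norm_real, norm_inv, norm_norm,
            inv_mul_cancel₀ (hn' t j).ne']⟩
      have hγc : Continuous γ := by
        refine continuous_pi fun j => Continuous.subtype_mk ?_ _
        have hu : Continuous fun t : ℝ => φ j + ((t:ℂ) * w j) • e := by fun_prop
        exact (Complex.continuous_ofReal.comp (hu.norm.inv₀ fun t => (hn' t j).ne')).smul hu
      have hγ0 : γ 0 = φ₀ := by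
        funext j
        apply Subtype.ext
        simp only [γ]
        simp [hφ]
        rfl
      have ht : Tendsto γ (𝓝 0) (𝓝 φ₀) := by
        have := hγc.tendsto 0
        rwa [hγ0] at this
      filter_upwards [ht.eventually hmin] with t hmt
      rw [hFP0, hFP] at hmt
      refine hmt.trans (le_of_eq ?_)
      refine Finset.sum_congr rfl fun j _ => Finset.sum_congr rfl fun k _ => ?_
      simp only [γ]
      rw [inner_smul_left, inner_smul_right, norm_mul, norm_mul, RCLike.norm_conj,
        Complex.norm_real, Complex.norm_real, norm_inv, norm_inv, norm_norm, norm_norm,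
        mul_pow, mul_pow, inv_pow, inv_pow, hn, hn, mul_assoc])
    have hterm : ∀ k ∈ Finset.univ, ‖w k‖^2 * (lam k - μ) = 0 := by
      rw [← Finset.sum_eq_zero_iff_of_nonneg]
      · apply le_antisymm
        · have h8 : ∑ k, ‖w k‖^2 * (μ - lam k) = - ∑ k, ‖w k‖^2 * (lam k - μ) := by
            rw [← Finset.sum_neg_distrib]
            exact Finset.sum_congr rfl fun k _ => by ring
          have h9 : 0 ≤ ∑ k, ‖w k‖^2 * (μ - lam k) := hsec
          linarith
        · exact Finset.sum_nonneg fun k _ => mul_nonneg (by positivity) (sub_nonneg.2 (hlamμ k))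
      · exact fun k _ => mul_nonneg (by positivity) (sub_nonneg.2 (hlamμ k))
    intro k
    rcases mul_eq_zero.1 (hterm k (Finset.mem_univ k)) with h | h
    · have h0 : w k = 0 := by simpa using h
      rcases mul_eq_zero.1 h0 with h1 | h1
      · have : c k = 0 := by simpa using h1
        rw [this, zero_mul]
      · rw [h1, mul_zero]
    · rw [h]; simp
  have hdich : ∀ k, lam k = 1 ∨ lam k = μ := by
    intro k
    have h1 := hkey (fun j => ⟪φ j, φ k⟫_ℂ - if j = k then (lam k : ℂ) else 0) (by
      simp only [sub_smul, Finset.sum_sub_distrib, ite_smul, zero_smul, Finset.sum_ite_eq',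
        Finset.mem_univ, if_true]
      rw [← fpS_apply, hfirst', sub_self]) k
    simp only [if_true, inner_self_eq_norm_sq_to_K, hφ] at h1
    rcases mul_eq_zero.1 h1 with h | h
    · left
      have h2 : (lam k : ℂ) = 1 := by
        simp at h
        linear_combination -h
      exact_mod_cast h2
    · right
      have h2 : lam k - μ = 0 := by exact_mod_cast h
      linarith
  have hlam1 : ∀ k, 1 ≤ lam k := fp_lower_one φ hφ
  have hFPlam : FP φ₀ = ∑ k, lam k := by rw [hFP0, Finset.sum_comm]
  rw [hFPlam]
  rcases lt_or_ge μ 1 with hμ1 | hμ1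
  · have : ∀ k, lam k = 1 := fun k => (hdich k).resolve_right (by intro h; have := hlam1 k; linarith)
    rw [Finset.sum_congr rfl fun k _ => this k, hFP, Finset.sum_comm]
    refine Finset.sum_le_sum fun k _ => ?_
    exact fp_lower_one (fun j => (ψ j : EuclideanSpace ℂ (Fin N))) hψ k
  · have hall : ∀ k, lam k = μ := fun k => by
      rcases hdich k with h | h
      · have := hlamμ k; linarith
      · exact h
    have hlow := fp_lower (EuclideanSpace.basisFun (Fin N) ℂ) (fun j => (ψ j : EuclideanSpace ℂ (Fin N))) hψ
    rw [← hFP, Fintype.card_fin] at hlow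
    have htr := fp_trace (EuclideanSpace.basisFun (Fin N) ℂ) φ hφ
    have hNμ : N * μ ≤ s := by
      rw [← htr]
      have := Finset.sum_le_sum (s := (Finset.univ : Finset (Fin N))) (f := fun _ => μ)
        (fun i _ => hμle (EuclideanSpace.basisFun (Fin N) ℂ i) ((EuclideanSpace.basisFun (Fin N) ℂ).norm_eq_one i))
      simpa using this
    simp only [hall, Finset.sum_const, Finset.card_univ, Fintype.card_fin, nsmul_eq_mul]
    have hspos : (0:ℝ) < s := by exact_mod_cast hs
    have hNpos : (0:ℝ) < N := by
      rcases Nat.eq_zero_or_pos N with h | h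
      · subst h; simp at hlow; omega
      · exact_mod_cast h
    have h10 : (N:ℝ) * (s * μ) ≤ N * FP ψ := by nlinarith
    exact le_of_mul_le_mul_left h10 hNpos
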